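/- arXiv:2509.26631 — 8 statements merged into one kernel-verified Lean document; each statement's English description precedes it below -/
import Mathlib

section
/- Let D, D' be positive natural numbers and let W_F, W_B, W_O : Matrix (Fin D') (Fin D) ℝ each satisfy the row-sum constraint (every row sums to 1). For V : Matrix (Fin D) (Fin 3) ℝ set F(V) = W_F * V, B(V) = W_B * V, O(V) = W_O * V, F_O(V) = F(V) − O(V), B_O(V) = B(V) − O(V). Then for every s : ℝ with 0 < s, every R : Matrix (Fin 3) (Fin 3) ℝ with R * Rᵀ = 1 and det R = 1, and every t : Fin 3 → ℝ, writing g·V = s • (V * R) + T_D(t): F_O(g·V) = s • (F_O(V) * R), B_O(g·V) = s • (B_O(V) * R), and ⟨F_O(g·V), B_O(g·V)⟩_F = s^2 * ⟨F_O(V), B_O(V)⟩_F. -/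
open Matrix

/-- The matrix with every row equal to `t`. -/
def Tmat (D : ℕ) (t : Fin 3 → ℝ) : Matrix (Fin D) (Fin 3) ℝ :=
  Matrix.of fun _ j => t j

/-- Frobenius inner product of two matrices. -/
def frob {m n : ℕ} (A B : Matrix (Fin m) (Fin n) ℝ) : ℝ :=
  ∑ i, ∑ j, A i j * B i j

theorem mul_Tmat {D D' : ℕ} {W : Matrix (Fin D') (Fin D) ℝ} (hW : ∀ i, ∑ j, W i j = 1)
    (t : Fin 3 → ℝ) : W * Tmat D t = Tmat D' t := by
  ext i j
  simp [Matrix.mul_apply, Tmat, ← Finset.sum_mul, hW]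

theorem mul_similarity_sub {D D' : ℕ} {W W' : Matrix (Fin D') (Fin D) ℝ}
    (hW : ∀ i, ∑ j, W i j = 1) (hW' : ∀ i, ∑ j, W' i j = 1)
    (s : ℝ) (R : Matrix (Fin 3) (Fin 3) ℝ) (t : Fin 3 → ℝ) (V : Matrix (Fin D) (Fin 3) ℝ) :
    W * (s • (V * R) + Tmat D t) - W' * (s • (V * R) + Tmat D t)
      = s • ((W * V - W' * V) * R) := by
  rw [Matrix.mul_add, Matrix.mul_add, mul_Tmat hW, mul_Tmat hW', add_sub_add_right_eq_sub,
    Matrix.mul_smul, Matrix.mul_smul, ← smul_sub, Matrix.sub_mul, Matrix.mul_assoc,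
    Matrix.mul_assoc]

theorem frob_eq_trace {m n : ℕ} (A B : Matrix (Fin m) (Fin n) ℝ) :
    frob A B = (A * Bᵀ).trace := by
  simp [frob, Matrix.trace, Matrix.mul_apply]

theorem frob_smul_mul_of_mul_transpose_eq_one {m n : ℕ} {R : Matrix (Fin n) (Fin n) ℝ}
    (hR : R * Rᵀ = 1) (s : ℝ) (A B : Matrix (Fin m) (Fin n) ℝ) :
    frob (s • (A * R)) (s • (B * R)) = s ^ 2 * frob A B := by
  have h : A * R * (B * R)ᵀ = A * Bᵀ := by
    rw [Matrix.transpose_mul, Matrix.mul_assoc, ← Matrix.mul_assoc R, hR, Matrix.one_mul]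
  rw [frob_eq_trace, frob_eq_trace, Matrix.transpose_smul, Matrix.smul_mul, Matrix.mul_smul, h,
    smul_smul, Matrix.trace_smul, smul_eq_mul, sq]

theorem vnrelu_ingredients_sim3
    (D D' : ℕ) (hD : 0 < D) (hD' : 0 < D')
    (WF WB WO : Matrix (Fin D') (Fin D) ℝ)
    (hWF : ∀ i, ∑ j, WF i j = 1) (hWB : ∀ i, ∑ j, WB i j = 1)
    (hWO : ∀ i, ∑ j, WO i j = 1)
    (s : ℝ) (hs : 0 < s)
    (R : Matrix (Fin 3) (Fin 3) ℝ) (hR : R * Rᵀ = 1) (hdet : R.det = 1)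
    (t : Fin 3 → ℝ) (V : Matrix (Fin D) (Fin 3) ℝ) :
    (WF * (s • (V * R) + Tmat D t) - WO * (s • (V * R) + Tmat D t)
        = s • ((WF * V - WO * V) * R)) ∧
    (WB * (s • (V * R) + Tmat D t) - WO * (s • (V * R) + Tmat D t)
        = s • ((WB * V - WO * V) * R)) ∧
    (frob (WF * (s • (V * R) + Tmat D t) - WO * (s • (V * R) + Tmat D t))
          (WB * (s • (V * R) + Tmat D t) - WO * (s • (V * R) + Tmat D t))
        = s ^ 2 * frob (WF * V - WO * V) (WB * V - WO * V)) := by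
  have hF := mul_similarity_sub hWF hWO s R t V
  have hB := mul_similarity_sub hWB hWO s R t V
  refine ⟨hF, hB, ?_⟩
  rw [hF, hB, frob_smul_mul_of_mul_transpose_eq_one hR]
end

section
/- Let D, D' be positive natural numbers and let W_F, W_B, W_O : Matrix (Fin D') (Fin D) ℝ each satisfy the row-sum constraint (every row sums to 1). For V : Matrix (Fin D) (Fin 3) ℝ set F(V) = W_F * V, B(V) = W_B * V, O(V) = W_O * V, F_O(V) = F(V) − O(V), B_O(V) = B(V) − O(V), and define the VN-ReLU map VNReLU(V) = if 0 ≤ ⟨F_O(V), B_O(V)⟩_F then F(V) else F(V) − (⟨F_O(V), B_O(V)⟩_F / ⟨B_O(V), B_O(V)⟩_F) • B_O(V). Then VNReLU is SIM(3)-equivariant: for every s : ℝ with 0 < s, every R : Matrix (Fin 3) (Fin 3) ℝ with R * Rᵀ = 1 and det R = 1, and every t : Fin 3 → ℝ, VNReLU(s • (V * R) + T_D(t)) = s • (VNReLU(V) * R) + T_{D'}(t). -/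
open Matrix

/-- The VN-ReLU nonlinearity built from three VN-Linear layers. -/
noncomputable def VNReLU (D D' : ℕ) (WF WB WO : Matrix (Fin D') (Fin D) ℝ)
    (V : Matrix (Fin D) (Fin 3) ℝ) : Matrix (Fin D') (Fin 3) ℝ :=
  let F := WF * V
  let B := WB * V
  let O := WO * V
  let FO := F - O
  let BO := B - O
  if 0 ≤ frob FO BO then F else F - (frob FO BO / frob BO BO) • BO

theorem frob_smul_smul {m n : ℕ} (c d : ℝ) (A B : Matrix (Fin m) (Fin n) ℝ) :
    frob (c • A) (d • B) = c * d * frob A B := by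
  simp [frob_eq_trace, mul_assoc, mul_left_comm]

/-- The Frobenius inner product is invariant under right multiplication by an orthogonal matrix. -/
theorem frob_mul_right {m n : ℕ} {R : Matrix (Fin n) (Fin n) ℝ} (hR : R * Rᵀ = 1)
    (A B : Matrix (Fin m) (Fin n) ℝ) : frob (A * R) (B * R) = frob A B := by
  rw [frob_eq_trace, frob_eq_trace, Matrix.transpose_mul, Matrix.mul_assoc,
    ← Matrix.mul_assoc R, hR, Matrix.one_mul]

/-- A linear layer with unit row sums is equivariant under similarity transforms. -/
theorem mul_smul_mul_add_Tmat {D D' : ℕ} {W : Matrix (Fin D') (Fin D) ℝ}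
    (hW : ∀ i, ∑ j, W i j = 1) (s : ℝ) (R : Matrix (Fin 3) (Fin 3) ℝ) (t : Fin 3 → ℝ)
    (V : Matrix (Fin D) (Fin 3) ℝ) :
    W * (s • (V * R) + Tmat D t) = s • (W * V * R) + Tmat D' t := by
  rw [Matrix.mul_add, mul_Tmat hW, Matrix.mul_smul, Matrix.mul_assoc]

theorem vnrelu_sim3_equivariant
    (D D' : ℕ) (hD : 0 < D) (hD' : 0 < D')
    (WF WB WO : Matrix (Fin D') (Fin D) ℝ)
    (hWF : ∀ i, ∑ j, WF i j = 1) (hWB : ∀ i, ∑ j, WB i j = 1)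
    (hWO : ∀ i, ∑ j, WO i j = 1)
    (s : ℝ) (hs : 0 < s)
    (R : Matrix (Fin 3) (Fin 3) ℝ) (hR : R * Rᵀ = 1) (hdet : R.det = 1)
    (t : Fin 3 → ℝ) (V : Matrix (Fin D) (Fin 3) ℝ) :
    VNReLU D D' WF WB WO (s • (V * R) + Tmat D t)
      = s • (VNReLU D D' WF WB WO V * R) + Tmat D' t := by
  have hss : 0 < s * s := mul_pos hs hs
  simp only [VNReLU, mul_smul_mul_add_Tmat hWF, mul_smul_mul_add_Tmat hWB,
    mul_smul_mul_add_Tmat hWO, add_sub_add_right_eq_sub, ← smul_sub, ← Matrix.sub_mul _ _ R,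
    frob_smul_smul, frob_mul_right hR, mul_nonneg_iff_of_pos_left hss,
    mul_div_mul_left _ _ hss.ne']
  split_ifs
  · rfl
  · simp only [Matrix.sub_mul _ _ R, Matrix.smul_mul, smul_sub s, smul_comm s, sub_add_eq_add_sub]
end

section
/- Let D be a positive natural number and V : Matrix (Fin D) (Fin 3) ℝ with channel mean V̄ j = (1/D) ∑ d, V d j. Assume for every channel d that the centered row is nonzero, i.e. (fun j => V d j − V̄ j) ≠ 0. Set n(V) d = Real.sqrt (∑ j, (V d j − V̄ j)^2) and define VN-LayerNorm by VNLN(V) d j = LN(n(V)) d * (V d j − V̄ j) / n(V) d, where LN(u) d = (u d − μ)/σ with μ = (1/D) ∑ d, u d and σ = Real.sqrt ((1/D) ∑ d, (u d − μ)^2). Then VN-LayerNorm is invariant to scaling and translation and equivariant to rotation: for every s : ℝ with 0 < s, every R : Matrix (Fin 3) (Fin 3) ℝ with R * Rᵀ = 1 and det R = 1, and every t : Fin 3 → ℝ, VNLN(s • (V * R) + T_D(t)) = VNLN(V) * R. -/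
open Matrix

/-- Layer normalization of a vector of channel magnitudes. -/
noncomputable def LN (D : ℕ) (u : Fin D → ℝ) : Fin D → ℝ :=
  fun d =>
    (u d - (1 / (D : ℝ)) * ∑ d', u d') /
      Real.sqrt ((1 / (D : ℝ)) * ∑ d', (u d' - (1 / (D : ℝ)) * ∑ d'', u d'') ^ 2)

/-- Channel mean of a vector feature. -/
noncomputable def chMean (D : ℕ) (V : Matrix (Fin D) (Fin 3) ℝ) : Fin 3 → ℝ :=
  fun j => (1 / (D : ℝ)) * ∑ d, V d j

/-- Row-wise norms of the centered vector feature. -/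
noncomputable def rowNorm (D : ℕ) (V : Matrix (Fin D) (Fin 3) ℝ) : Fin D → ℝ :=
  fun d => Real.sqrt (∑ j, (V d j - chMean D V j) ^ 2)

/-- VN-LayerNorm. -/
noncomputable def VNLN (D : ℕ) (V : Matrix (Fin D) (Fin 3) ℝ) :
    Matrix (Fin D) (Fin 3) ℝ :=
  Matrix.of fun d j => LN D (rowNorm D V) d * (V d j - chMean D V j) / rowNorm D V d

/-- Layer normalization is invariant under positive scaling. -/
lemma LN_smul (D : ℕ) {s : ℝ} (hs : 0 < s) (u : Fin D → ℝ) :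
    LN D (fun d => s * u d) = LN D u := by
  funext d
  have hcenter (d : Fin D) : s * u d - (1 / (D : ℝ)) * ∑ d', s * u d'
      = s * (u d - (1 / (D : ℝ)) * ∑ d', u d') := by
    rw [← Finset.mul_sum]; ring
  have hvar : (1 / (D : ℝ)) * ∑ d', (s * (u d' - (1 / (D : ℝ)) * ∑ d'', u d'')) ^ 2
      = s ^ 2 * ((1 / (D : ℝ)) * ∑ d', (u d' - (1 / (D : ℝ)) * ∑ d'', u d'') ^ 2) := by
    simp_rw [mul_pow]
    rw [← Finset.mul_sum]; ring
  simp only [LN, hcenter]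
  rw [hvar, Real.sqrt_mul (sq_nonneg s), Real.sqrt_sq hs.le, mul_div_mul_left _ _ hs.ne']

/-- Centering removes translations and commutes with linear maps. -/
lemma sub_chMean_similarity {D : ℕ} (hD : 0 < D) (V : Matrix (Fin D) (Fin 3) ℝ) (s : ℝ)
    (R : Matrix (Fin 3) (Fin 3) ℝ) (t : Fin 3 → ℝ) (d : Fin D) (j : Fin 3) :
    (s • (V * R) + Tmat D t) d j - chMean D (s • (V * R) + Tmat D t) j
      = s * ((fun k => V d k - chMean D V k) ᵥ* R) j := by
  have hD' : (D : ℝ) ≠ 0 := by exact_mod_cast hD.ne'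
  simp only [chMean, Tmat, Matrix.add_apply, Matrix.smul_apply, Matrix.mul_apply, Matrix.of_apply,
    smul_eq_mul, Matrix.vecMul, dotProduct, Fin.sum_univ_three, Finset.sum_add_distrib,
    ← Finset.mul_sum, ← Finset.sum_mul, Finset.sum_const, Finset.card_univ, Fintype.card_fin,
    nsmul_eq_mul]
  field_simp
  ring

/-- Orthogonal matrices preserve the sum of squares of a row vector. -/
lemma sum_sq_vecMul {n : Type*} [Fintype n] [DecidableEq n] {R : Matrix n n ℝ}
    (hR : R * Rᵀ = 1) (x : n → ℝ) : ∑ j, (x ᵥ* R) j ^ 2 = ∑ j, x j ^ 2 := by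
  have h : (x ᵥ* R) ⬝ᵥ (x ᵥ* R) = x ⬝ᵥ x := by
    rw [← Matrix.dotProduct_mulVec, ← Matrix.vecMul_transpose, Matrix.vecMul_vecMul, hR,
      Matrix.vecMul_one]
  simpa only [dotProduct, ← sq] using h

/-- Row norms scale with the similarity factor. -/
lemma rowNorm_similarity {D : ℕ} (hD : 0 < D) (V : Matrix (Fin D) (Fin 3) ℝ) {s : ℝ}
    (hs : 0 < s) {R : Matrix (Fin 3) (Fin 3) ℝ} (hR : R * Rᵀ = 1) (t : Fin 3 → ℝ) :
    rowNorm D (s • (V * R) + Tmat D t) = fun d => s * rowNorm D V d := by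
  funext d
  simp only [rowNorm, sub_chMean_similarity hD, mul_pow]
  rw [← Finset.mul_sum, sum_sq_vecMul hR, Real.sqrt_mul (sq_nonneg s), Real.sqrt_sq hs.le]

theorem vnLayerNorm_sim3
    (D : ℕ) (hD : 0 < D) (V : Matrix (Fin D) (Fin 3) ℝ)
    (hV : ∀ d, (fun j => V d j - chMean D V j) ≠ 0)
    (s : ℝ) (hs : 0 < s)
    (R : Matrix (Fin 3) (Fin 3) ℝ) (hR : R * Rᵀ = 1) (hdet : R.det = 1)
    (t : Fin 3 → ℝ) :
    VNLN D (s • (V * R) + Tmat D t) = VNLN D V * R := by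
  ext d j
  simp only [VNLN, Matrix.of_apply, rowNorm_similarity hD V hs hR, LN_smul D hs,
    sub_chMean_similarity hD, Matrix.mul_apply]
  rw [mul_left_comm, mul_div_mul_left _ _ hs.ne', Matrix.vecMul, dotProduct, Finset.mul_sum,
    Finset.sum_div]
  exact Finset.sum_congr rfl fun k _ => by ring
end

section
/- Let D, N, M be positive natural numbers, W_Q, W_K : Matrix (Fin D) (Fin D) ℝ, and let U : Fin N → Matrix (Fin D) (Fin 3) ℝ and K : Fin M → Matrix (Fin D) (Fin 3) ℝ be families of vector features. Define attention weights a(U, K) i j = softmax(fun j' => ⟨W_Q * U i, W_K * K j'⟩_F / Real.sqrt (3 * D)) j. Then the attention weights are rotation-invariant: for every R : Matrix (Fin 3) (Fin 3) ℝ with R * Rᵀ = 1 and det R = 1, a(fun i => (U i) * R, fun j => (K j) * R) = a(U, K). -/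
open Matrix

/-- Softmax of a finite family of reals. -/
noncomputable def softmax (M : ℕ) (x : Fin M → ℝ) : Fin M → ℝ :=
  fun j => Real.exp (x j) / ∑ j', Real.exp (x j')

/-- Attention weights between two families of vector features. -/
noncomputable def attnWeights (D N M : ℕ) (WQ WK : Matrix (Fin D) (Fin D) ℝ)
    (U : Fin N → Matrix (Fin D) (Fin 3) ℝ) (K : Fin M → Matrix (Fin D) (Fin 3) ℝ)
    (i : Fin N) : Fin M → ℝ :=
  softmax M (fun j' => frob (WQ * U i) (WK * K j') / Real.sqrt (3 * (D : ℝ)))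

theorem frob_mul_right_of_mul_transpose_eq_one {m n : ℕ} (A B : Matrix (Fin m) (Fin n) ℝ)
    {R : Matrix (Fin n) (Fin n) ℝ} (hR : R * Rᵀ = 1) :
    frob (A * R) (B * R) = frob A B := by
  rw [frob_eq_trace, frob_eq_trace, transpose_mul, Matrix.mul_assoc, ← Matrix.mul_assoc R, hR,
    Matrix.one_mul]

theorem attention_weights_rotation_invariant
    (D N M : ℕ) (hD : 0 < D) (hN : 0 < N) (hM : 0 < M)
    (WQ WK : Matrix (Fin D) (Fin D) ℝ)
    (U : Fin N → Matrix (Fin D) (Fin 3) ℝ) (K : Fin M → Matrix (Fin D) (Fin 3) ℝ)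
    (R : Matrix (Fin 3) (Fin 3) ℝ) (hR : R * Rᵀ = 1) (hdet : R.det = 1) :
    attnWeights D N M WQ WK (fun i => U i * R) (fun j => K j * R) =
      attnWeights D N M WQ WK U K := by
  funext i
  simp only [attnWeights, ← Matrix.mul_assoc, frob_mul_right_of_mul_transpose_eq_one _ _ hR]
end

section
/- Let D, N, M be positive natural numbers, W_Q, W_K, W_V : Matrix (Fin D) (Fin D) ℝ, and let U : Fin N → Matrix (Fin D) (Fin 3) ℝ and K : Fin M → Matrix (Fin D) (Fin 3) ℝ be families of vector features. Define attention weights a(U, K) i j = softmax(fun j' => ⟨W_Q * U i, W_K * K j'⟩_F / Real.sqrt (3 * D)) j and attention outputs Z(U, K) i = ∑ j, a(U, K) i j • (W_V * K j). Then the attention output is rotation-equivariant: for every R : Matrix (Fin 3) (Fin 3) ℝ with R * Rᵀ = 1 and det R = 1 and every i, Z(fun i' => (U i') * R, fun j => (K j) * R) i = (Z(U, K) i) * R. -/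
open Matrix

/-- Attention output. -/
noncomputable def attnOut (D N M : ℕ) (WQ WK WV : Matrix (Fin D) (Fin D) ℝ)
    (U : Fin N → Matrix (Fin D) (Fin 3) ℝ) (K : Fin M → Matrix (Fin D) (Fin 3) ℝ)
    (i : Fin N) : Matrix (Fin D) (Fin 3) ℝ :=
  ∑ j, attnWeights D N M WQ WK U K i j • (WV * K j)

theorem attnWeights_mul_right {D N M : ℕ} (WQ WK : Matrix (Fin D) (Fin D) ℝ)
    (U : Fin N → Matrix (Fin D) (Fin 3) ℝ) (K : Fin M → Matrix (Fin D) (Fin 3) ℝ)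
    {R : Matrix (Fin 3) (Fin 3) ℝ} (hR : R * Rᵀ = 1) (i : Fin N) :
    attnWeights D N M WQ WK (fun i' => U i' * R) (fun j => K j * R) i =
      attnWeights D N M WQ WK U K i := by
  simp only [attnWeights, ← Matrix.mul_assoc, frob_mul_right_of_mul_transpose_eq_one _ _ hR]

theorem attention_output_rotation_equivariant
    (D N M : ℕ) (hD : 0 < D) (hN : 0 < N) (hM : 0 < M)
    (WQ WK WV : Matrix (Fin D) (Fin D) ℝ)
    (U : Fin N → Matrix (Fin D) (Fin 3) ℝ) (K : Fin M → Matrix (Fin D) (Fin 3) ℝ)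
    (R : Matrix (Fin 3) (Fin 3) ℝ) (hR : R * Rᵀ = 1) (hdet : R.det = 1)
    (i : Fin N) :
    attnOut D N M WQ WK WV (fun i' => U i' * R) (fun j => K j * R) i =
      attnOut D N M WQ WK WV U K i * R := by
  simp only [attnOut, attnWeights_mul_right WQ WK U K hR, Matrix.sum_mul, Matrix.smul_mul,
    Matrix.mul_assoc]
end

section
/- Let D, M be positive natural numbers and V : Fin M → Matrix (Fin D) (Fin 3) ℝ a family of vector features. Define the global scale statistic μ(V) = (1/D) ∑ d, Real.sqrt (∑ j, ((1/M) ∑ i, ((V i) d j − V̄_i j))^2), where V̄_i j = (1/D) ∑ d', (V i) d' j is the channel mean of V i. Then μ scales equivariantly under similarity transforms: for every s : ℝ with 0 < s, every R : Matrix (Fin 3) (Fin 3) ℝ with R * Rᵀ = 1 and det R = 1, and every t : Fin 3 → ℝ, μ(fun i => s • ((V i) * R) + T_D(t)) = s * μ(V). -/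
open Matrix

/-- Global scale statistic of a family of vector features. -/
noncomputable def scaleStat (D M : ℕ) (V : Fin M → Matrix (Fin D) (Fin 3) ℝ) : ℝ :=
  (1 / (D : ℝ)) * ∑ d,
    Real.sqrt (∑ j, ((1 / (M : ℝ)) * ∑ i, ((V i) d j - chMean D (V i) j)) ^ 2)

/-- The channel mean is equivariant under similarity transforms. -/
theorem chMean_smul_mul_add_Tmat {D : ℕ} (hD : 0 < D) (V : Matrix (Fin D) (Fin 3) ℝ) (s : ℝ)
    (R : Matrix (Fin 3) (Fin 3) ℝ) (t : Fin 3 → ℝ) :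
    chMean D (s • (V * R) + Tmat D t) = s • (chMean D V ᵥ* R) + t := by
  have hD' : (D : ℝ) ≠ 0 := by positivity
  ext j
  simp only [chMean, Tmat, Matrix.add_apply, Matrix.smul_apply, Matrix.mul_apply, Matrix.of_apply,
    smul_eq_mul, Finset.sum_add_distrib, Finset.sum_const, Finset.card_univ, Fintype.card_fin,
    nsmul_eq_mul, Pi.add_apply, Pi.smul_apply, Matrix.vecMul, dotProduct, Fin.sum_univ_three,
    ← Finset.mul_sum, ← Finset.sum_mul]
  field_simp

/-- Right multiplication by an orthogonal matrix preserves the sum of squares of a row vector. -/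
theorem sum_sq_vecMul_of_mul_transpose_eq_one {n : Type*} [Fintype n] [DecidableEq n]
    {R : Matrix n n ℝ} (hR : R * Rᵀ = 1) (w : n → ℝ) :
    ∑ j, (w ᵥ* R) j ^ 2 = ∑ j, w j ^ 2 := by
  have h : (w ᵥ* R) ⬝ᵥ (w ᵥ* R) = w ⬝ᵥ w := by
    rw [← Matrix.dotProduct_mulVec, ← Matrix.vecMul_transpose, Matrix.vecMul_vecMul, hR,
      Matrix.vecMul_one]
  simpa only [dotProduct, ← pow_two] using h

theorem scale_statistic_sim3
    (D M : ℕ) (hD : 0 < D) (hM : 0 < M)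
    (V : Fin M → Matrix (Fin D) (Fin 3) ℝ)
    (s : ℝ) (hs : 0 < s)
    (R : Matrix (Fin 3) (Fin 3) ℝ) (hR : R * Rᵀ = 1) (hdet : R.det = 1)
    (t : Fin 3 → ℝ) :
    scaleStat D M (fun i => s • (V i * R) + Tmat D t) = s * scaleStat D M V := by
  unfold scaleStat
  rw [mul_left_comm, Finset.mul_sum _ _ s]
  congr 1
  refine Finset.sum_congr rfl fun d _ => ?_
  set w : Fin 3 → ℝ := fun j => (1 / (M : ℝ)) * ∑ i, (V i d j - chMean D (V i) j) with hw
  have key : ∀ j, (1 / (M : ℝ)) * ∑ i, ((s • (V i * R) + Tmat D t) d j -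
      chMean D (s • (V i * R) + Tmat D t) j) = s * (w ᵥ* R) j := by
    intro j
    simp only [chMean_smul_mul_add_Tmat hD]
    simp only [hw, Tmat, Matrix.add_apply, Matrix.smul_apply,
      Matrix.mul_apply, Matrix.of_apply, smul_eq_mul, Pi.add_apply, Pi.smul_apply, Matrix.vecMul,
      dotProduct, Fin.sum_univ_three, add_sub_add_right_eq_sub, Finset.sum_sub_distrib,
      Finset.sum_add_distrib, ← Finset.mul_sum, ← Finset.sum_mul]
    ring
  simp_rw [key, mul_pow s]
  rw [← Finset.mul_sum, sum_sq_vecMul_of_mul_transpose_eq_one hR, Real.sqrt_mul (sq_nonneg s),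
    Real.sqrt_sq hs.le]
end

section
/- Let D, M be positive natural numbers and V : Fin M → Matrix (Fin D) (Fin 3) ℝ a family of per-point vector features with global mean V̄ = (1/M) ∑ i, V i (a matrix in Matrix (Fin D) (Fin 3) ℝ). Define the edge feature E(V) i j = V j + V̄ − V i. Then the edge feature is SIM(3)-equivariant: for every s : ℝ with 0 < s, every R : Matrix (Fin 3) (Fin 3) ℝ with R * Rᵀ = 1 and det R = 1, and every t : Fin 3 → ℝ, E(fun k => s • ((V k) * R) + T_D(t)) i j = s • ((E(V) i j) * R) + T_D(t) for all i, j : Fin M. -/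
open Matrix

/-- Edge feature of VN-DGCNN: `E(V) i j = V j + V̄ − V i` with global mean `V̄`. -/
noncomputable def edgeFeat (D M : ℕ) (V : Fin M → Matrix (Fin D) (Fin 3) ℝ)
    (i j : Fin M) : Matrix (Fin D) (Fin 3) ℝ :=
  V j + (1 / (M : ℝ)) • (∑ k, V k) - V i

theorem edge_feature_sim3_equivariant
    (D M : ℕ) (hD : 0 < D) (hM : 0 < M)
    (V : Fin M → Matrix (Fin D) (Fin 3) ℝ)
    (s : ℝ) (hs : 0 < s)
    (R : Matrix (Fin 3) (Fin 3) ℝ) (hR : R * Rᵀ = 1) (hdet : R.det = 1)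
    (t : Fin 3 → ℝ) (i j : Fin M) :
    edgeFeat D M (fun k => s • (V k * R) + Tmat D t) i j =
      s • (edgeFeat D M V i j * R) + Tmat D t := by
  have hM' : (M : ℝ) ≠ 0 := by positivity
  have hmean : (1 / (M : ℝ)) • ∑ k, (s • (V k * R) + Tmat D t) =
      s • (((1 / (M : ℝ)) • ∑ k, V k) * R) + Tmat D t := by
    rw [Finset.sum_add_distrib, ← Finset.smul_sum, ← Matrix.sum_mul, Finset.sum_const,
      Finset.card_univ, Fintype.card_fin, ← Nat.cast_smul_eq_nsmul ℝ, smul_add, smul_smul _ (M : ℝ),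
      one_div_mul_cancel hM', one_smul, Matrix.smul_mul, smul_comm]
  simp only [edgeFeat, hmean, Matrix.sub_mul, Matrix.add_mul, smul_sub, smul_add]
  abel
end

section
/- Let D, D' be positive natural numbers and W : Matrix (Fin D') (Fin D) ℝ an arbitrary weight matrix. Define the reconstruction head ŷ(V, Q) = W * (V − C(V)) + Q for V : Matrix (Fin D) (Fin 3) ℝ and Q : Matrix (Fin D') (Fin 3) ℝ, where C(V) d j = (1/D) ∑ d', V d' j is the matrix whose every row is the channel mean of V. Then the reconstruction head is SIM(3)-equivariant when V and Q transform jointly: for every s : ℝ with 0 < s, every R : Matrix (Fin 3) (Fin 3) ℝ with R * Rᵀ = 1 and det R = 1, and every t : Fin 3 → ℝ, ŷ(s • (V * R) + T_D(t), s • (Q * R) + T_{D'}(t)) = s • (ŷ(V, Q) * R) + T_{D'}(t). -/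
open Matrix

/-- The matrix whose every row is the channel mean of `V`. -/
noncomputable def centerMat (D : ℕ) (V : Matrix (Fin D) (Fin 3) ℝ) :
    Matrix (Fin D) (Fin 3) ℝ :=
  Matrix.of fun _ j => (1 / (D : ℝ)) * ∑ d', V d' j

/-- Reconstruction head: `ŷ(V, Q) = W * (V − C(V)) + Q`. -/
noncomputable def reconHead (D D' : ℕ) (W : Matrix (Fin D') (Fin D) ℝ)
    (V : Matrix (Fin D) (Fin 3) ℝ) (Q : Matrix (Fin D') (Fin 3) ℝ) :
    Matrix (Fin D') (Fin 3) ℝ :=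
  W * (V - centerMat D V) + Q

/-- The channel mean is equivariant under affine maps acting on the rows. -/
theorem centerMat_smul_mul_add_Tmat {D : ℕ} (hD : 0 < D) (V : Matrix (Fin D) (Fin 3) ℝ)
    (s : ℝ) (R : Matrix (Fin 3) (Fin 3) ℝ) (t : Fin 3 → ℝ) :
    centerMat D (s • (V * R) + Tmat D t) = s • (centerMat D V * R) + Tmat D t := by
  have hD0 : (D : ℝ) ≠ 0 := by exact_mod_cast hD.ne'
  ext d j
  simp only [centerMat, Tmat, Matrix.add_apply, Matrix.smul_apply, Matrix.of_apply,
    Matrix.mul_apply, Fin.sum_univ_three, smul_eq_mul, Finset.sum_add_distrib,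
    ← Finset.mul_sum, ← Finset.sum_mul, Finset.sum_const, Finset.card_univ,
    Fintype.card_fin, nsmul_eq_mul]
  field_simp

theorem reconstruction_head_sim3_equivariant
    (D D' : ℕ) (hD : 0 < D) (hD' : 0 < D')
    (W : Matrix (Fin D') (Fin D) ℝ)
    (V : Matrix (Fin D) (Fin 3) ℝ) (Q : Matrix (Fin D') (Fin 3) ℝ)
    (s : ℝ) (hs : 0 < s)
    (R : Matrix (Fin 3) (Fin 3) ℝ) (hR : R * Rᵀ = 1) (hdet : R.det = 1)
    (t : Fin 3 → ℝ) :
    reconHead D D' W (s • (V * R) + Tmat D t) (s • (Q * R) + Tmat D' t) =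
      s • (reconHead D D' W V Q * R) + Tmat D' t := by
  rw [reconHead, reconHead, centerMat_smul_mul_add_Tmat hD, add_sub_add_right_eq_sub,
    ← smul_sub, ← Matrix.sub_mul, Matrix.mul_smul, ← Matrix.mul_assoc, Matrix.add_mul,
    smul_add, add_assoc]
end
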